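/- Let H = (1/√2) • !![1, 1; 1, -1] be the Hadamard matrix, let S be the SWAP matrix on ℂ² ⊗ ℂ², let CH be the controlled-Hadamard (controlled unitary with U_0 = identity, U_1 = H, control on the first factor), and set V = CH * S. Then for the input state ψ = e_0: (a) any 2×2 density matrix ρ satisfying the Deutsch self-consistency condition ρ = Tr₁[V (|ψ⟩⟨ψ| ⊗ ρ) V†] equals |e_0⟩⟨e_0|, and (b) the output state Tr₂[V (|ψ⟩⟨ψ| ⊗ |e_0⟩⟨e_0|) V†] equals |e_0⟩⟨e_0|. -/

import Mathlib

open Matrix Kronecker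
open scoped ComplexConjugate ComplexOrder

noncomputable section

/-- The `j`-th standard basis vector of `ℂ^N`. -/
def stdVec {N : ℕ} (j : Fin N) : Fin N → ℂ := fun i => if i = j then 1 else 0

/-- The outer product `|φ⟩⟨χ|`. -/
def outer {ι : Type*} (φ χ : ι → ℂ) : Matrix ι ι ℂ :=
  Matrix.of fun m n => φ m * conj (χ n)

/-- Partial trace over the first tensor factor. -/
def ptrace1 {d N : ℕ} (M : Matrix (Fin d × Fin N) (Fin d × Fin N) ℂ) :
    Matrix (Fin N) (Fin N) ℂ :=
  Matrix.of fun m n => ∑ s : Fin d, M (s, m) (s, n)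

/-- Partial trace over the second tensor factor. -/
def ptrace2 {d N : ℕ} (M : Matrix (Fin d × Fin N) (Fin d × Fin N) ℂ) :
    Matrix (Fin d) (Fin d) ℂ :=
  Matrix.of fun m n => ∑ s : Fin N, M (m, s) (n, s)

/-- The SWAP matrix on `ℂ^N ⊗ ℂ^N`. -/
def swapMat (N : ℕ) : Matrix (Fin N × Fin N) (Fin N × Fin N) ℂ :=
  Matrix.of fun p q => if p.1 = q.2 ∧ p.2 = q.1 then 1 else 0

/-- The controlled unitary `Σ_k |k⟩⟨k| ⊗ U_k` (control on the first factor). -/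
def ctrlU {N : ℕ} (U : Fin N → Matrix (Fin N) (Fin N) ℂ) :
    Matrix (Fin N × Fin N) (Fin N × Fin N) ℂ :=
  Matrix.of fun p q => if p.1 = q.1 then U p.1 p.2 q.2 else 0

/-- The Hadamard matrix. -/
def Hmat : Matrix (Fin 2) (Fin 2) ℂ :=
  ((1 / Real.sqrt 2 : ℝ) : ℂ) • !![1, 1; 1, -1]

/-- The controlled-Hadamard gate (`U_0 = I`, `U_1 = H`, control on the first factor). -/
def CH : Matrix (Fin 2 × Fin 2) (Fin 2 × Fin 2) ℂ :=
  ctrlU ![(1 : Matrix (Fin 2) (Fin 2) ℂ), Hmat]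

/-- Entries of the controlled unitary preceded by a SWAP. -/
theorem ctrlU_mul_swapMat_apply {N : ℕ} (U : Fin N → Matrix (Fin N) (Fin N) ℂ)
    (p q : Fin N × Fin N) :
    (ctrlU U * swapMat N) p q = if p.1 = q.2 then U p.1 p.2 q.1 else 0 := by
  simp [Matrix.mul_apply, ctrlU, swapMat, Fintype.sum_prod_type, ite_and]

/-- Conjugating `|φ⟩⟨χ| ⊗ ρ` by the controlled unitary preceded by a SWAP moves `ρ` to the control
and applies the `U_k` to the vectors `φ` and `χ`. -/
theorem ctrlU_mul_swapMat_conj_apply {N : ℕ} (U : Fin N → Matrix (Fin N) (Fin N) ℂ)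
    (φ χ : Fin N → ℂ) (ρ : Matrix (Fin N) (Fin N) ℂ) (p q : Fin N × Fin N) :
    ((ctrlU U * swapMat N) * (outer φ χ ⊗ₖ ρ) * (ctrlU U * swapMat N)ᴴ) p q =
      ρ p.1 q.1 * (U p.1 *ᵥ φ) p.2 * conj ((U q.1 *ᵥ χ) q.2) := by
  rw [Matrix.mul_apply]
  simp only [Matrix.mul_apply (M := ctrlU U * swapMat N), conjTranspose_apply,
    ctrlU_mul_swapMat_apply, Fintype.sum_prod_type, kroneckerMap_apply, outer, of_apply,
    apply_ite star, star_zero, ite_mul, mul_ite, zero_mul, mul_zero, Finset.sum_ite_eq,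
    Finset.mem_univ, if_true, mulVec, dotProduct, map_sum, map_mul, Finset.sum_mul,
    Finset.mul_sum, starRingEnd_apply]
  refine Finset.sum_congr rfl fun _ _ => Finset.sum_congr rfl fun _ _ => ?_
  ring

/-- The Hadamard matrix sends `|0⟩` to the uniform superposition. -/
theorem Hmat_mulVec_stdVec_zero (i : Fin 2) :
    (Hmat *ᵥ stdVec 0) i = ((1 / Real.sqrt 2 : ℝ) : ℂ) := by
  fin_cases i <;> simp [Hmat, stdVec, mulVec, dotProduct]

theorem one_div_sqrt_two_mul_self :
    ((1 / Real.sqrt 2 : ℝ) : ℂ) * ((1 / Real.sqrt 2 : ℝ) : ℂ) = 1 / 2 := by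
  rw [← Complex.ofReal_mul, div_mul_div_comm, Real.mul_self_sqrt zero_le_two]
  norm_num

/-- For input `|0⟩`, the unique self-consistent CTC state of the
controlled-Hadamard-after-SWAP circuit is `|0⟩⟨0|`, and the output state is `|0⟩⟨0|`. -/
theorem ctc_circuit_on_zero :
    (∀ ρ : Matrix (Fin 2) (Fin 2) ℂ, ρ.PosSemidef → ρ.trace = 1 →
        ρ = ptrace1 ((CH * swapMat 2) *
              (outer (stdVec 0) (stdVec 0) ⊗ₖ ρ) * (CH * swapMat 2)ᴴ) →
        ρ = outer (stdVec 0) (stdVec 0)) ∧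
    ptrace2 ((CH * swapMat 2) *
        (outer (stdVec 0) (stdVec 0) ⊗ₖ outer (stdVec 0) (stdVec 0)) *
        (CH * swapMat 2)ᴴ) = outer (stdVec 0) (stdVec 0) := by
  constructor
  · intro ρ _ htr h
    have entry (m n : Fin 2) :
        ρ m n = ρ 0 0 * stdVec 0 m * conj (stdVec 0 n) + ρ 1 1 * (1 / 2) := by
      conv_lhs => rw [h]
      simp only [ptrace1, CH, of_apply, ctrlU_mul_swapMat_conj_apply, Fin.sum_univ_two,
        cons_val_zero, cons_val_one, one_mulVec, Hmat_mulVec_stdVec_zero, Complex.conj_ofReal]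
      rw [mul_assoc (ρ 1 1), one_div_sqrt_two_mul_self]
    have h11 : ρ 1 1 = 0 := by
      have := entry 0 0
      simpa [stdVec] using this
    have h00 : ρ 0 0 = 1 := by
      simpa [trace_fin_two, h11] using htr
    ext m n
    simp [entry m n, h00, h11, outer]
  · ext m n
    simp only [ptrace2, CH, of_apply, ctrlU_mul_swapMat_conj_apply, Fin.sum_univ_two]
    fin_cases m <;> fin_cases n <;> simp [outer, stdVec]
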